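/- Let Ω ⊆ ℝ^d be open, let μ : [0,1] × Ω → ℝ and v : [0,1] × Ω → ℝ^d be C¹, and let f : [0,1] → ℝ be continuous. Suppose the unnormalized continuity equation ∂_t μ(t,x) + ∇·(μ(t,x) v(t,x)) = f(t) holds for all (t,x) ∈ [0,1] × Ω. Define m(x) = ∫₀¹ μ(t,x) v(t,x) dt. Then m is differentiable on Ω and for every x ∈ Ω, μ(1,x) − μ(0,x) − ∫₀¹ f(t) dt + ∇·m(x) = 0. -/

import Mathlib

open MeasureTheory

/-- The (spatial) divergence of a vector field `w` on `ℝ^d` at a point `x`: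
`∇·w (x) = ∑ i ∂_{x_i} w_i (x)`. -/
noncomputable def diverg {d : ℕ}
    (w : EuclideanSpace ℝ (Fin d) → EuclideanSpace ℝ (Fin d))
    (x : EuclideanSpace ℝ (Fin d)) : ℝ :=
  ∑ i, fderiv ℝ w x (EuclideanSpace.single i 1) i

/-- The partial derivative in the second variable, as a continuous linear map. -/
theorem hasFDerivAt_prodMk_right_comp {E F : Type*} [NormedAddCommGroup E] [NormedSpace ℝ E]
    [NormedAddCommGroup F] [NormedSpace ℝ F] {G : ℝ × E → F} (hG : Differentiable ℝ G)
    (t : ℝ) (x : E) :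
    HasFDerivAt (fun y => G (t, y))
      ((fderiv ℝ G (t, x)).comp (ContinuousLinearMap.inr ℝ ℝ E)) x :=
  (hG (t, x)).hasFDerivAt.comp x (hasFDerivAt_prodMk_right t x)

/-- Differentiation under an interval integral of a `C¹` integrand. -/
theorem ContDiff.hasFDerivAt_intervalIntegral {E F : Type*} [NormedAddCommGroup E]
    [NormedSpace ℝ E] [ProperSpace E] [NormedAddCommGroup F] [NormedSpace ℝ F]
    {G : ℝ × E → F} (hG : ContDiff ℝ 1 G) (a b : ℝ) (x : E) :
    HasFDerivAt (fun y => ∫ t in a..b, G (t, y))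
      (∫ t in a..b, (fderiv ℝ G (t, x)).comp (ContinuousLinearMap.inr ℝ ℝ E)) x := by
  have hc : Continuous fun p : ℝ × E =>
      (fderiv ℝ G p).comp (ContinuousLinearMap.inr ℝ ℝ E) :=
    (hG.continuous_fderiv one_ne_zero).clm_comp continuous_const
  obtain ⟨C, hC⟩ := (isCompact_uIcc (a := a) (b := b)).prod (isCompact_closedBall x 1)
    |>.exists_bound_of_continuousOn hc.continuousOn
  refine intervalIntegral.hasFDerivAt_integral_of_dominated_of_fderiv_le
    (F := fun y t => G (t, y))
    (F' := fun y t => (fderiv ℝ G (t, y)).comp (ContinuousLinearMap.inr ℝ ℝ E))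
    (bound := fun _ => C) (Metric.closedBall_mem_nhds x one_pos) ?_ ?_ ?_ ?_ ?_ ?_
  · exact .of_forall fun y =>
      (hG.continuous.comp (Continuous.prodMk_left y)).aestronglyMeasurable
  · exact (hG.continuous.comp (Continuous.prodMk_left x)).intervalIntegrable a b
  · exact (hc.comp (Continuous.prodMk_left x)).aestronglyMeasurable
  · exact .of_forall fun t ht y hy => hC (t, y) ⟨Set.uIoc_subset_uIcc ht, hy⟩
  · exact intervalIntegrable_const
  · exact .of_forall fun t _ y _ =>
      hasFDerivAt_prodMk_right_comp (hG.differentiable one_ne_zero) t y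

/-- The divergence at a point, as a continuous linear functional of the derivative. -/
noncomputable def divergCLM (d : ℕ) :
    (EuclideanSpace ℝ (Fin d) →L[ℝ] EuclideanSpace ℝ (Fin d)) →L[ℝ] ℝ :=
  ∑ i, (EuclideanSpace.proj i).comp
    (ContinuousLinearMap.apply ℝ (EuclideanSpace ℝ (Fin d)) (EuclideanSpace.single i (1 : ℝ)))

theorem HasFDerivAt.diverg_eq {d : ℕ}
    {w : EuclideanSpace ℝ (Fin d) → EuclideanSpace ℝ (Fin d)}
    {L : EuclideanSpace ℝ (Fin d) →L[ℝ] EuclideanSpace ℝ (Fin d)}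
    {x : EuclideanSpace ℝ (Fin d)} (h : HasFDerivAt w L x) :
    diverg w x = divergCLM d L := by
  simp [diverg, divergCLM, h.fderiv]

/-- If the unnormalized continuity equation
`∂_t μ + ∇·(μ v) = f(t)` holds on `[0,1] × Ω` (`Ω` open), then the time-integrated flux
`m(x) = ∫₀¹ μ(t,x) v(t,x) dt` is differentiable on `Ω` and satisfies the static
divergence constraint `μ₁ - μ₀ - ∫₀¹ f + ∇·m = 0` on `Ω`. -/
theorem stmt1 {d : ℕ} (Ω : Set (EuclideanSpace ℝ (Fin d))) (hΩ : IsOpen Ω)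
    (μ : ℝ → EuclideanSpace ℝ (Fin d) → ℝ)
    (v : ℝ → EuclideanSpace ℝ (Fin d) → EuclideanSpace ℝ (Fin d))
    (f : ℝ → ℝ)
    (hμ : ContDiff ℝ 1 (fun p : ℝ × EuclideanSpace ℝ (Fin d) => μ p.1 p.2))
    (hv : ContDiff ℝ 1 (fun p : ℝ × EuclideanSpace ℝ (Fin d) => v p.1 p.2))
    (hf : ContinuousOn f (Set.Icc 0 1))
    (hpde : ∀ t ∈ Set.Icc (0:ℝ) 1, ∀ x ∈ Ω,
      deriv (fun s => μ s x) t + diverg (fun y => μ t y • v t y) x = f t)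
    (m : EuclideanSpace ℝ (Fin d) → EuclideanSpace ℝ (Fin d))
    (hm : ∀ x, m x = ∫ t in (0:ℝ)..1, μ t x • v t x) :
    ∀ x ∈ Ω, DifferentiableAt ℝ m x ∧
      μ 1 x - μ 0 x - (∫ t in (0:ℝ)..1, f t) + diverg m x = 0 := by
  intro x hx
  have hG : ContDiff ℝ 1 fun p : ℝ × EuclideanSpace ℝ (Fin d) => μ p.1 p.2 • v p.1 p.2 :=
    hμ.smul hv
  set L : ℝ → EuclideanSpace ℝ (Fin d) →L[ℝ] EuclideanSpace ℝ (Fin d) := fun t =>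
    (fderiv ℝ (fun p : ℝ × EuclideanSpace ℝ (Fin d) => μ p.1 p.2 • v p.1 p.2) (t, x)).comp
      (ContinuousLinearMap.inr ℝ ℝ (EuclideanSpace ℝ (Fin d)))
  have hL_cont : Continuous L :=
    ((hG.continuous_fderiv one_ne_zero).comp (Continuous.prodMk_left x)).clm_comp continuous_const
  have hm' : HasFDerivAt m (∫ t in (0:ℝ)..1, L t) x := by
    rw [funext hm]
    exact hG.hasFDerivAt_intervalIntegral 0 1 x
  have hμx : ContDiff ℝ 1 fun s => μ s x := hμ.comp (contDiff_prodMk_left x)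
  have hdμ : Continuous (deriv fun s => μ s x) := hμx.continuous_deriv le_rfl
  have hftc : ∫ t in (0:ℝ)..1, deriv (fun s => μ s x) t = μ 1 x - μ 0 x :=
    intervalIntegral.integral_deriv_eq_sub
      (fun t _ => hμx.differentiable one_ne_zero t) (hdμ.intervalIntegrable 0 1)
  have hdiv : diverg m x = ∫ t in (0:ℝ)..1, divergCLM d (L t) := by
    rw [hm'.diverg_eq,
      (divergCLM d).intervalIntegral_comp_comm (hL_cont.intervalIntegrable 0 1)]
  have hf_int : ∫ t in (0:ℝ)..1, f t =
      ∫ t in (0:ℝ)..1, (deriv (fun s => μ s x) t + divergCLM d (L t)) := by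
    refine intervalIntegral.integral_congr fun t ht => ?_
    rw [Set.uIcc_of_le zero_le_one] at ht
    have hLt : HasFDerivAt (fun y => μ t y • v t y) (L t) x :=
      hasFDerivAt_prodMk_right_comp (hG.differentiable one_ne_zero) t x
    simp only [← hpde t ht x hx, hLt.diverg_eq]
  have hdiv_cont : Continuous fun t => divergCLM d (L t) :=
    (divergCLM d).continuous.comp hL_cont
  refine ⟨hm'.differentiableAt, ?_⟩
  rw [hf_int, intervalIntegral.integral_add (hdμ.intervalIntegrable 0 1)
    (hdiv_cont.intervalIntegrable 0 1), hftc, hdiv]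
  ring
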